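/- arXiv:2501.10354 — 2 statements merged into one kernel-verified Lean document; each statement's English description precedes it below -/
import Mathlib

section
/- Let (Γ_l(j))_{1≤l≤t, 1≤j≤n} be a family of subsets of [n] satisfying the exact (r,t,s)-condition, and let A ⊆ [n] be any subset. Then there exist pairwise distinct j₁,…,j_N ∈ [n]∖A with N = ⌈(n−|A|)·p_e(r,t,s)⌉ such that for every k with 1 ≤ k ≤ N there is at least one α ∈ [t] with Γ_α(j_k) ∩ {j₁, j₂, …, j_{k−1}} = ∅. -/
/-- The family `(Γ_l(j))` of subsets of `[n]` satisfies the exact `(r,t,s)`-condition. -/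
def ExactCondition (n r t s : ℕ) (Γ : Fin n → Fin t → Finset (Fin n)) : Prop :=
  (∀ (j : Fin n) (l : Fin t), (Γ j l).card = r + 1 ∧ j ∈ Γ j l) ∧
  (∀ (j : Fin n) (l₁ l₂ : Fin t), l₁ ≠ l₂ → (Γ j l₁ ∩ Γ j l₂).card = s + 1) ∧
  (∀ (j : Fin n) (l₁ l₂ l₃ : Fin t), l₁ ≠ l₂ → l₁ ≠ l₃ → l₂ ≠ l₃ →
    Γ j l₁ ∩ Γ j l₂ ∩ Γ j l₃ = {j})

/-- `N_e(r,L,s)` as a rational number. -/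
def NeQ (r L s : ℕ) : ℚ :=
  1 + (L : ℚ) * (r : ℚ) - (s : ℚ) * (L : ℚ) * ((L : ℚ) - 1) / 2

/-- `p_e(r,t,s) = Σ_{L=1}^{t} (−1)^{L+1}·C(t,L)/N_e(r,L,s)`. -/
def pe (r t s : ℕ) : ℚ :=
  ∑ L ∈ Finset.Icc 1 t, (-1 : ℚ) ^ (L + 1) * (t.choose L : ℚ) / NeQ r L s

open Finset in
/-- Cardinality of a union of sets of size `r` with pairwise intersections of size `s` and empty
triple intersections. -/
theorem card_biUnion_of_triple_disjoint {ι α : Type*} [DecidableEq ι] [DecidableEq α]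
    (G : ι → Finset α) (r s : ℕ) (hr : ∀ l, #(G l) = r)
    (hs : ∀ a b, a ≠ b → #(G a ∩ G b) = s)
    (h3 : ∀ a b c, a ≠ b → a ≠ c → b ≠ c → G a ∩ G b ∩ G c = ∅) (S : Finset ι) :
    (#(S.biUnion G) : ℚ) = (#S : ℚ) * r - (s : ℚ) * #S * ((#S : ℚ) - 1) / 2 := by
  induction S using Finset.induction_on with
  | empty => simp
  | insert a S ha ih =>
    have hinter : #(G a ∩ S.biUnion G) = #S * s := by
      rw [inter_biUnion, card_biUnion, sum_const_nat]
      · intro b hb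
        exact hs a b (fun h => ha (h ▸ hb))
      · intro b hb c hc hbc
        refine disjoint_iff_inter_eq_empty.2 ?_
        have := h3 a b c (fun h => ha (h ▸ hb)) (fun h => ha (h ▸ hc)) hbc
        rw [← this]
        ext x
        simp only [mem_inter]
        tauto
    have hunion := card_union_add_card_inter (G a) (S.biUnion G)
    rw [hinter, hr, ← biUnion_insert] at hunion
    have hunion' : (#((insert a S).biUnion G) : ℚ) + #S * s = r + #(S.biUnion G) := by
      exact_mod_cast hunion
    rw [card_insert_of_notMem ha]
    push_cast
    rw [ih] at hunion'
    linarith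

open Finset in
theorem ExactCondition.card_biUnion {n r t s : ℕ} {Γ : Fin n → Fin t → Finset (Fin n)}
    (h : ExactCondition n r t s Γ) (j : Fin n) {S : Finset (Fin t)} (hS : S.Nonempty) :
    (#(S.biUnion (Γ j)) : ℚ) = NeQ r #S s := by
  obtain ⟨h1, h2, h3⟩ := h
  have key := card_biUnion_of_triple_disjoint (fun l => (Γ j l).erase j) r s
    (fun l => by rw [card_erase_of_mem (h1 j l).2, (h1 j l).1]; rfl)
    (fun a b hab => by
      have he : (Γ j a).erase j ∩ (Γ j b).erase j = (Γ j a ∩ Γ j b).erase j := by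
        ext x
        simp only [mem_inter, mem_erase]
        tauto
      rw [he, card_erase_of_mem (mem_inter.2 ⟨(h1 j a).2, (h1 j b).2⟩), h2 j a b hab]
      rfl)
    (fun a b c hab hac hbc => by
      have he : (Γ j a).erase j ∩ (Γ j b).erase j ∩ (Γ j c).erase j
          = (Γ j a ∩ Γ j b ∩ Γ j c).erase j := by
        ext x
        simp only [mem_inter, mem_erase]
        tauto
      rw [he, h3 j a b c hab hac hbc]
      simp) S
  have hj : j ∈ S.biUnion (Γ j) := by
    obtain ⟨l, hl⟩ := hS
    exact mem_biUnion.2 ⟨l, hl, (h1 j l).2⟩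
  rw [← erase_biUnion] at key
  have hcard : (#((S.biUnion (Γ j)).erase j) : ℚ) + 1 = #(S.biUnion (Γ j)) := by
    exact_mod_cast card_erase_add_one hj
  rw [← hcard, key, NeQ]
  ring

open Finset in
/-- The orderings of `Fin n` in which `j` comes first within `U`. -/
def permsWithFirst {n : ℕ} (U : Finset (Fin n)) (j : Fin n) : Finset (Equiv.Perm (Fin n)) :=
  univ.filter fun π => ∀ i ∈ U, π j ≤ π i

theorem mem_permsWithFirst {n : ℕ} {U : Finset (Fin n)} {j : Fin n} {π : Equiv.Perm (Fin n)} :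
    π ∈ permsWithFirst U j ↔ ∀ i ∈ U, π j ≤ π i := by
  simp [permsWithFirst]

open Finset in
theorem card_permsWithFirst_le {n : ℕ} {U : Finset (Fin n)} {j k : Fin n} (hj : j ∈ U)
    (hk : k ∈ U) : #(permsWithFirst U j) ≤ #(permsWithFirst U k) := by
  refine card_le_card_of_injOn (fun π => π * Equiv.swap j k) ?_ ?_
  · intro π hπ
    have hπ := mem_permsWithFirst.1 hπ
    refine mem_permsWithFirst.2 fun i hi => ?_
    simp only [Equiv.Perm.mul_apply, Equiv.swap_apply_right]
    refine hπ _ ?_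
    rw [Equiv.swap_apply_def]
    split_ifs <;> assumption
  · intro π _ σ _ h
    exact mul_right_cancel h

open Finset in
theorem card_mul_card_permsWithFirst {n : ℕ} {U : Finset (Fin n)} {j : Fin n} (hj : j ∈ U) :
    #U * #(permsWithFirst U j) = Fintype.card (Equiv.Perm (Fin n)) := by
  have hcover : U.biUnion (permsWithFirst U) = univ := by
    refine eq_univ_iff_forall.2 fun π => ?_
    obtain ⟨k, hk, hmin⟩ := exists_min_image U π ⟨j, hj⟩
    exact mem_biUnion.2 ⟨k, hk, mem_permsWithFirst.2 hmin⟩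
  rw [← card_univ, ← hcover, card_biUnion, sum_const_nat]
  · intro k hk
    exact le_antisymm (card_permsWithFirst_le hk hj) (card_permsWithFirst_le hj hk)
  · intro a ha b hb hab
    refine disjoint_left.2 fun π h h' => hab ?_
    exact π.injective
      (le_antisymm (mem_permsWithFirst.1 h b hb) (mem_permsWithFirst.1 h' a ha))

open Finset in
theorem ExactCondition.card_biUnion_permsWithFirst {n r t s : ℕ}
    {Γ : Fin n → Fin t → Finset (Fin n)} (h : ExactCondition n r t s Γ) (j : Fin n) :
    (#(univ.biUnion fun l => permsWithFirst (Γ j l) j) : ℚ)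
      = Fintype.card (Equiv.Perm (Fin n)) * pe r t s := by
  have hinf : ∀ (S : Finset (Fin t)) (hS : S.Nonempty),
      (#(S.inf' hS fun l => permsWithFirst (Γ j l) j) : ℚ)
        = Fintype.card (Equiv.Perm (Fin n)) / NeQ r #S s := by
    intro S hS
    have he : (S.inf' hS fun l => permsWithFirst (Γ j l) j)
        = permsWithFirst (S.biUnion (Γ j)) j := by
      ext π
      simp only [mem_inf', mem_permsWithFirst, mem_biUnion]
      exact ⟨fun H i ⟨l, hl, hi⟩ => H l hl i hi, fun H l hl i hi => H i ⟨l, hl, hi⟩⟩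
    have hj : j ∈ S.biUnion (Γ j) := by
      obtain ⟨l, hl⟩ := hS
      exact mem_biUnion.2 ⟨l, hl, (h.1 j l).2⟩
    have hpos : (#(S.biUnion (Γ j)) : ℚ) ≠ 0 := by
      exact_mod_cast (card_pos.2 ⟨j, hj⟩).ne'
    rw [he, ← h.card_biUnion j hS, ← card_mul_card_permsWithFirst hj]
    push_cast
    field_simp
  have hie := inclusion_exclusion_card_biUnion (univ : Finset (Fin t))
    (fun l => permsWithFirst (Γ j l) j)
  have hie' := congrArg (Int.cast : ℤ → ℚ) hie
  push_cast at hie'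
  rw [hie']
  let g : ℕ → ℚ := fun L => if L = 0 then 0 else
    (-1 : ℚ) ^ (L + 1) * (Fintype.card (Equiv.Perm (Fin n)) / NeQ r L s)
  calc _ = ∑ S : {S // S ∈ (univ : Finset (Fin t)).powerset.filter (·.Nonempty)}, g #S.1 := by
        refine sum_congr rfl fun S _ => ?_
        have hS := (mem_filter.1 S.2).2
        rw [hinf S.1 hS]
        simp [g, hS.ne_empty]
    _ = ∑ S ∈ (univ : Finset (Fin t)).powerset.filter (·.Nonempty), g #S :=
        sum_coe_sort _ fun S => g #S
    _ = ∑ S ∈ (univ : Finset (Fin t)).powerset, g #S := by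
        refine sum_filter_of_ne fun S _ hS => ?_
        rw [nonempty_iff_ne_empty]
        rintro rfl
        simp [g] at hS
    _ = ∑ L ∈ range (t + 1), (t.choose L : ℚ) * g L := by
        rw [sum_powerset_apply_card]
        simp
    _ = ∑ L ∈ Icc 1 t, (t.choose L : ℚ) * g L := by
        refine (sum_subset (fun L hL => ?_) fun L hL hL' => ?_).symm
        · simp only [mem_Icc, mem_range] at *
          omega
        · have : L = 0 := by
            simp only [mem_Icc, mem_range] at *
            omega
          simp [g, this]
    _ = _ := by
        rw [pe, mul_sum]
        refine sum_congr rfl fun L hL => ?_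
        have : L ≠ 0 := by
          have := (mem_Icc.1 hL).1
          omega
        simp only [g, if_neg this]
        ring

open Finset in
/-- Averaging over all orderings, one of them has many points outside `A` coming first in one of
their neighbourhoods. -/
theorem ExactCondition.exists_perm {n r t s : ℕ} {Γ : Fin n → Fin t → Finset (Fin n)}
    (h : ExactCondition n r t s Γ) (A : Finset (Fin n)) :
    ∃ π : Equiv.Perm (Fin n), ((n - #A : ℕ) : ℚ) * pe r t s
      ≤ #{j ∈ Aᶜ | ∃ l, ∀ i ∈ Γ j l, π j ≤ π i} := by
  have hcount : ∑ π : Equiv.Perm (Fin n), (#{j ∈ Aᶜ | ∃ l, ∀ i ∈ Γ j l, π j ≤ π i} : ℚ)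
      = ∑ j ∈ Aᶜ, (#(univ.biUnion fun l => permsWithFirst (Γ j l) j) : ℚ) := by
    have := sum_card_bipartiteAbove_eq_sum_card_bipartiteBelow
      (s := (univ : Finset (Equiv.Perm (Fin n)))) (t := Aᶜ)
      (fun π j => ∃ l, ∀ i ∈ Γ j l, π j ≤ π i)
    have hb : ∀ j, bipartiteBelow (fun (π : Equiv.Perm (Fin n)) j => ∃ l, ∀ i ∈ Γ j l, π j ≤ π i)
        univ j = univ.biUnion fun l => permsWithFirst (Γ j l) j := by
      intro j
      ext π
      simp [bipartiteBelow, mem_permsWithFirst]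
    simp only [hb] at this
    exact_mod_cast this
  obtain ⟨π, _, hπ⟩ := exists_le_of_sum_le (s := (univ : Finset (Equiv.Perm (Fin n))))
    (f := fun _ => ((n - #A : ℕ) : ℚ) * pe r t s)
    (g := fun π : Equiv.Perm (Fin n) => (#{j ∈ Aᶜ | ∃ l, ∀ i ∈ Γ j l, π j ≤ π i} : ℚ)) univ_nonempty (by
      rw [hcount, sum_congr rfl fun j _ => h.card_biUnion_permsWithFirst j]
      simp only [sum_const, card_univ, card_compl, Fintype.card_fin, nsmul_eq_mul]
      apply le_of_eq
      ring)
  exact ⟨π, hπ⟩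

theorem exists_greedy_sequence_exact (n r t s : ℕ)
    (Γ : Fin n → Fin t → Finset (Fin n)) (hexact : ExactCondition n r t s Γ)
    (A : Finset (Fin n)) :
    ∃ f : Fin ((⌈((n - A.card : ℕ) : ℚ) * pe r t s⌉).toNat) → Fin n,
      Function.Injective f ∧ (∀ k, f k ∉ A) ∧
      ∀ k : Fin ((⌈((n - A.card : ℕ) : ℚ) * pe r t s⌉).toNat),
        ∃ α : Fin t, ∀ i : Fin ((⌈((n - A.card : ℕ) : ℚ) * pe r t s⌉).toNat),
          i < k → f i ∉ Γ (f k) α := by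
  obtain ⟨π, hπ⟩ := hexact.exists_perm A
  generalize ((n - A.card : ℕ) : ℚ) * pe r t s = q at hπ ⊢
  set C : Finset (Fin n) := {j ∈ Aᶜ | ∃ l, ∀ i ∈ Γ j l, π j ≤ π i}
  have hN : ⌈q⌉.toNat ≤ (C.map π.toEmbedding).card := by
    rw [Finset.card_map, Int.toNat_le, Int.ceil_le]
    exact_mod_cast hπ
  let e := (C.map π.toEmbedding).orderEmbOfFin rfl
  have hmem : ∀ k, π.symm (e k) ∈ C := fun k => by
    simpa using Finset.orderEmbOfFin_mem (C.map π.toEmbedding) rfl k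
  refine ⟨fun k => π.symm (e (Fin.castLE hN k)), ?_, ?_, ?_⟩
  · intro a b hab
    exact Fin.castLE_injective hN (e.injective (π.symm.injective hab))
  · intro k
    exact Finset.mem_compl.1 (Finset.mem_filter.1 (hmem _)).1
  · intro k
    obtain ⟨l, hl⟩ := (Finset.mem_filter.1 (hmem (Fin.castLE hN k))).2
    refine ⟨l, fun i hik hi => ?_⟩
    have hle := hl _ hi
    simp only [Equiv.apply_symm_apply] at hle
    have hlt : e (Fin.castLE hN i) < e (Fin.castLE hN k) := e.strictMono hik
    exact absurd hle (not_le.2 hlt)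
end

section
/- Let n, r, t, s be positive integers and let (Γ_l(j))_{1≤l≤t, 1≤j≤n} be a family of subsets of [n] with j ∈ Γ_l(j) for all l and j, such that for every j ∈ [n] and every nonempty subset S ⊆ [t] one has N̲(r,|S|,s) ≤ |⋃_{α∈S} Γ_α(j)| ≤ N̄(r,|S|,s) (as holds, by a result of Kruglik–Frolov, when each |Γ_l(j)| ≤ r+1 and |Γ_{l₁}(j) ∩ Γ_{l₂}(j)| ≤ s+1 for l₁ ≠ l₂). Then for any subset A ⊆ [n] there exist pairwise distinct j₁,…,j_N ∈ [n]∖A with N = ⌈(n−|A|)·p₂(r,t,s)⌉ such that for every k with 1 ≤ k ≤ N there is at least one α ∈ [t] with Γ_α(j_k) ∩ {j₁, j₂, …, j_{k−1}} = ∅. -/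
/-- `x := min{L, ⌊r/s⌋+1}`. -/
def xval (r s L : ℕ) : ℕ := min L (r / s + 1)

/-- `N̲(r,L,s) = x(2r−(x−1)s)/2 + 1` where `x = min{L, ⌊r/s⌋+1}`. -/
def Nlow (r L s : ℕ) : ℚ :=
  (xval r s L : ℚ) * (2 * (r : ℚ) - ((xval r s L : ℚ) - 1) * (s : ℚ)) / 2 + 1

/-- `N̄(r,L,s) = Lr + 1`. -/
def Nhigh (r L s : ℕ) : ℚ := (L : ℚ) * (r : ℚ) + 1

/-- `p₂(r,t,s) = Σ_{L odd} C(t,L)/N̄(r,L,s) − Σ_{L even} C(t,L)/N̲(r,L,s)`,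
sums over `1 ≤ L ≤ t`. -/
def p2 (r t s : ℕ) : ℚ :=
  ∑ L ∈ (Finset.Icc 1 t).filter (fun L => L % 2 = 1), (t.choose L : ℚ) / Nhigh r L s
  - ∑ L ∈ (Finset.Icc 1 t).filter (fun L => L % 2 = 0), (t.choose L : ℚ) / Nlow r L s

open Finset in
/-- The permutations for which `j` comes first among the elements of `U`. -/
def firstPerms {n : ℕ} (U : Finset (Fin n)) (j : Fin n) : Finset (Equiv.Perm (Fin n)) :=
  univ.filter fun σ => ∀ x ∈ U, σ j ≤ σ x

open Finset in
lemma mem_firstPerms {n : ℕ} {U : Finset (Fin n)} {j : Fin n} {σ : Equiv.Perm (Fin n)} :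
    σ ∈ firstPerms U j ↔ ∀ x ∈ U, σ j ≤ σ x := by
  simp [firstPerms]

open Finset in
lemma card_firstPerms_eq {n : ℕ} {U : Finset (Fin n)} {a j : Fin n} (ha : a ∈ U) (hj : j ∈ U) :
    (firstPerms U a).card = (firstPerms U j).card := by
  have hU : ∀ x ∈ U, Equiv.swap a j x ∈ U := by
    intro x hx
    rw [Equiv.swap_apply_def]
    split_ifs <;> assumption
  refine card_bij' (fun σ _ => σ * Equiv.swap a j) (fun σ _ => σ * Equiv.swap a j) ?_ ?_ ?_ ?_
  · intro σ hσ
    rw [mem_firstPerms] at hσ ⊢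
    intro x hx
    simpa using hσ _ (hU x hx)
  · intro σ hσ
    rw [mem_firstPerms] at hσ ⊢
    intro x hx
    simpa using hσ _ (hU x hx)
  · intro σ _
    simp [mul_assoc]
  · intro σ _
    simp [mul_assoc]

open Finset in
/-- An element of `U` comes first among `U` with probability `1 / |U|`. -/
lemma card_mul_card_firstPerms {n : ℕ} {U : Finset (Fin n)} {j : Fin n} (hj : j ∈ U) :
    U.card * (firstPerms U j).card = n.factorial := by
  have hun : U.biUnion (firstPerms U) = univ := by
    refine eq_univ_of_forall fun σ => ?_
    obtain ⟨a, ha, hmin⟩ := exists_min_image U σ ⟨j, hj⟩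
    exact mem_biUnion.2 ⟨a, ha, mem_firstPerms.2 hmin⟩
  have hdisj : (U : Set (Fin n)).PairwiseDisjoint (firstPerms U) := by
    intro a ha b hb hab
    refine disjoint_left.2 fun σ hσa hσb => hab ?_
    exact σ.injective
      (le_antisymm (mem_firstPerms.1 hσa b hb) (mem_firstPerms.1 hσb a ha))
  have hcard := card_biUnion hdisj
  rw [hun, sum_congr rfl fun a ha => card_firstPerms_eq ha hj, sum_const, smul_eq_mul,
    card_univ, Fintype.card_perm, Fintype.card_fin] at hcard
  exact hcard.symm

lemma Nlow_pos (r L s : ℕ) : 0 < Nlow r L s := by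
  have hx : (xval r s L : ℚ) - 1 ≤ ((r / s : ℕ) : ℚ) := by
    have : xval r s L ≤ r / s + 1 := min_le_right _ _
    have : (xval r s L : ℚ) ≤ ((r / s + 1 : ℕ) : ℚ) := by exact_mod_cast this
    push_cast at this ⊢
    linarith
  have hrs : ((r / s : ℕ) : ℚ) * s ≤ r := by exact_mod_cast Nat.div_mul_le_self r s
  have hxs : ((xval r s L : ℚ) - 1) * s ≤ ((r / s : ℕ) : ℚ) * s :=
    mul_le_mul_of_nonneg_right hx (Nat.cast_nonneg s)
  have hr : (0 : ℚ) ≤ r := Nat.cast_nonneg r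
  have : (0 : ℚ) ≤ (xval r s L : ℚ) * (2 * (r : ℚ) - ((xval r s L : ℚ) - 1) * (s : ℚ)) :=
    mul_nonneg (Nat.cast_nonneg _) (by linarith)
  unfold Nlow
  linarith

/-- The summand of `p2` indexed by `L`, with its sign. -/
def p2Term (r s L : ℕ) : ℚ :=
  if L % 2 = 1 then 1 / Nhigh r L s else -(1 / Nlow r L s)

open Finset in
lemma p2_eq_sum_powerset (r t s : ℕ) :
    p2 r t s = ∑ S ∈ (univ : Finset (Fin t)).powerset with S.Nonempty, p2Term r s S.card := by
  have hpow : ∑ S ∈ (univ : Finset (Fin t)).powerset with S.Nonempty, p2Term r s S.card =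
      ∑ L ∈ Icc 1 t, (t.choose L : ℚ) * p2Term r s L := by
    have hmaps : ∀ S ∈ (univ : Finset (Fin t)).powerset.filter (·.Nonempty),
        S.card ∈ Icc 1 t := by
      intro S hS
      rw [mem_Icc]
      exact ⟨(mem_filter.1 hS).2.card_pos, by simpa using card_le_univ S⟩
    rw [← sum_fiberwise_of_maps_to hmaps]
    refine sum_congr rfl fun L hL => ?_
    have hfib : ((univ : Finset (Fin t)).powerset.filter (·.Nonempty)).filter
        (fun S => S.card = L) = powersetCard L univ := by
      ext S
      simp only [mem_filter, mem_powerset, mem_powersetCard]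
      refine ⟨fun h => ⟨h.1.1, h.2⟩, fun h => ⟨⟨h.1, ?_⟩, h.2⟩⟩
      rw [← card_pos, h.2]
      exact (mem_Icc.1 hL).1
    rw [hfib, sum_congr rfl fun S hS => by rw [(mem_powersetCard.1 hS).2], sum_const,
      card_powersetCard, card_univ, Fintype.card_fin, nsmul_eq_mul]
  have heven : (Icc 1 t).filter (fun L => L % 2 = 0) =
      (Icc 1 t).filter (fun L => ¬ L % 2 = 1) :=
    filter_congr fun L _ => by omega
  rw [hpow, p2, heven, ← sum_filter_add_sum_filter_not (Icc 1 t) (fun L => L % 2 = 1),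
    sub_eq_add_neg, ← sum_neg_distrib]
  congr 1
  · refine sum_congr rfl fun L hL => ?_
    rw [p2Term, if_pos (mem_filter.1 hL).2, mul_one_div]
  · refine sum_congr rfl fun L hL => ?_
    rw [p2Term, if_neg (mem_filter.1 hL).2, mul_neg, mul_one_div]

open Finset in
/-- At least a fraction `p2 r t s` of all permutations put `j` first in one of the sets `B l`. -/
lemma factorial_mul_p2_le_card_biUnion_firstPerms {n r t s : ℕ} (j : Fin n)
    (B : Fin t → Finset (Fin n)) (hmem : ∀ l, j ∈ B l)
    (hbound : ∀ S : Finset (Fin t), S.Nonempty →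
      Nlow r S.card s ≤ ((S.biUnion B).card : ℚ) ∧
      ((S.biUnion B).card : ℚ) ≤ Nhigh r S.card s) :
    (n.factorial : ℚ) * p2 r t s ≤
      ((univ.biUnion fun l => firstPerms (B l) j).card : ℚ) := by
  have hie := inclusion_exclusion_card_biUnion (univ : Finset (Fin t))
    fun l => firstPerms (B l) j
  rw [← Int.cast_natCast (R := ℚ) (card _), hie, p2_eq_sum_powerset, mul_sum, Int.cast_sum,
    ← sum_coe_sort]
  refine sum_le_sum fun S _ => ?_
  have hS : S.1.Nonempty := (mem_filter.1 S.2).2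
  have hinf : S.1.inf' hS (fun l => firstPerms (B l) j) = firstPerms (S.1.biUnion B) j := by
    ext σ
    rw [mem_inf', mem_firstPerms]
    simp only [mem_firstPerms, mem_biUnion]
    exact ⟨fun h x ⟨l, hl, hx⟩ => h l hl x hx, fun h l hl x hx => h x ⟨l, hl, hx⟩⟩
  rw [hinf]
  obtain ⟨l, hl⟩ := hS
  have hcard : ((S.1.biUnion B).card : ℚ) * ((firstPerms (S.1.biUnion B) j).card : ℚ) =
      n.factorial := by
    exact_mod_cast card_mul_card_firstPerms (mem_biUnion.2 ⟨l, hl, hmem l⟩)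
  have hpos : (0 : ℚ) < (S.1.biUnion B).card := by
    exact_mod_cast card_pos.2 ⟨j, mem_biUnion.2 ⟨l, hl, hmem l⟩⟩
  have hdiv : ((firstPerms (S.1.biUnion B) j).card : ℚ) =
      n.factorial * (1 / (S.1.biUnion B).card) := by
    rw [← hcard]
    field_simp
  obtain ⟨hlow, hhigh⟩ := hbound S.1 ⟨l, hl⟩
  push_cast
  rw [hdiv, mul_left_comm]
  refine mul_le_mul_of_nonneg_left ?_ (Nat.cast_nonneg _)
  rw [p2Term]
  split_ifs with hpar
  · rw [Even.neg_one_pow (by rw [Nat.even_iff]; omega), one_mul]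
    exact one_div_le_one_div_of_le hpos hhigh
  · rw [Odd.neg_one_pow (by rw [Nat.odd_iff]; omega), neg_one_mul]
    exact neg_le_neg (one_div_le_one_div_of_le (Nlow_pos _ _ _) hlow)

theorem exists_greedy_sequence_intersecting (n r t s : ℕ)
    (hn : 0 < n) (hr : 0 < r) (ht : 0 < t) (hs : 0 < s)
    (Γ : Fin n → Fin t → Finset (Fin n))
    (hmem : ∀ (j : Fin n) (l : Fin t), j ∈ Γ j l)
    (hbound : ∀ (j : Fin n) (S : Finset (Fin t)), S.Nonempty →
      Nlow r S.card s ≤ ((S.biUnion (Γ j)).card : ℚ) ∧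
      ((S.biUnion (Γ j)).card : ℚ) ≤ Nhigh r S.card s)
    (A : Finset (Fin n)) :
    ∃ f : Fin ((⌈((n - A.card : ℕ) : ℚ) * p2 r t s⌉).toNat) → Fin n,
      Function.Injective f ∧ (∀ k, f k ∉ A) ∧
      ∀ k : Fin ((⌈((n - A.card : ℕ) : ℚ) * p2 r t s⌉).toNat),
        ∃ α : Fin t, ∀ i : Fin ((⌈((n - A.card : ℕ) : ℚ) * p2 r t s⌉).toNat),
          i < k → f i ∉ Γ (f k) α := by
  classical
  let good : Equiv.Perm (Fin n) → Finset (Fin n) := fun σ =>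
    Aᶜ.filter fun j => σ ∈ Finset.univ.biUnion fun l => firstPerms (Γ j l) j
  obtain ⟨σ, hσ⟩ : ∃ σ, ((n - A.card : ℕ) : ℚ) * p2 r t s ≤ ((good σ).card : ℚ) := by
    have hsum : ∑ _σ : Equiv.Perm (Fin n), ((n - A.card : ℕ) : ℚ) * p2 r t s ≤
        ∑ σ : Equiv.Perm (Fin n), ((good σ).card : ℚ) := by
      have hswap : ∑ σ : Equiv.Perm (Fin n), (good σ).card =
          ∑ j ∈ Aᶜ, (Finset.univ.biUnion fun l => firstPerms (Γ j l) j).card := by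
        have := Finset.sum_card_bipartiteAbove_eq_sum_card_bipartiteBelow
          (s := (Finset.univ : Finset (Equiv.Perm (Fin n)))) (t := Aᶜ)
          fun σ j => σ ∈ Finset.univ.biUnion fun l => firstPerms (Γ j l) j
        simpa only [Finset.bipartiteAbove, Finset.bipartiteBelow, Finset.filter_univ_mem]
          using this
      have hle := Finset.card_nsmul_le_sum Aᶜ
        (fun j => ((Finset.univ.biUnion fun l => firstPerms (Γ j l) j).card : ℚ)) _
        fun j _ => factorial_mul_p2_le_card_biUnion_firstPerms j (Γ j) (hmem j) (hbound j)
      rw [Finset.sum_const, Finset.card_univ, Fintype.card_perm, Fintype.card_fin, nsmul_eq_mul,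
        ← Nat.cast_sum, hswap, Nat.cast_sum]
      rw [Finset.card_compl, Fintype.card_fin, nsmul_eq_mul] at hle
      linarith
    obtain ⟨σ, -, hσ⟩ := Finset.exists_le_of_sum_le Finset.univ_nonempty hsum
    exact ⟨σ, hσ⟩
  have hN : (⌈((n - A.card : ℕ) : ℚ) * p2 r t s⌉).toNat ≤ (good σ).card :=
    Int.toNat_le.2 (Int.ceil_le.2 (by exact_mod_cast hσ))
  let e := ((good σ).map σ.toEmbedding).orderEmbOfFin (Finset.card_map _)
  have hf : ∀ i, σ.symm (e i) ∈ good σ := by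
    intro i
    have hi := Finset.orderEmbOfFin_mem ((good σ).map σ.toEmbedding) (Finset.card_map _) i
    obtain ⟨x, hx, hxi⟩ := Finset.mem_map.1 hi
    have : σ.symm (e i) = x := (Equiv.symm_apply_eq σ).2 hxi.symm
    rwa [this]
  refine ⟨fun k => σ.symm (e (Fin.castLE hN k)), ?_, ?_, ?_⟩
  · exact σ.symm.injective.comp (e.injective.comp (Fin.castLE_injective hN))
  · exact fun k => Finset.mem_compl.1 (Finset.mem_filter.1 (hf _)).1
  · intro k
    obtain ⟨α, -, hα⟩ := Finset.mem_biUnion.1 (Finset.mem_filter.1 (hf (Fin.castLE hN k))).2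
    refine ⟨α, fun i hik hi => ?_⟩
    have hle := mem_firstPerms.1 hα _ hi
    rw [Equiv.apply_symm_apply, Equiv.apply_symm_apply] at hle
    exact absurd (e.le_iff_le.1 hle) (not_le.2 hik)
end
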